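/- Let l ≥ 0 and let Q ⊆ E^{l+1} be a closed convex set with nonempty interior which is an irredundant finite intersection Q = ⋂_{i ∈ I} H_i^+ of closed half-spaces (irredundant means that for every i ∈ I, ⋂_{j ≠ i} H_j^+ ≠ Q). If the recession cone rec(Q) has dimension l+1, then Q can be illuminated by a single point source: there exists a point q ∈ E^{l+1} such that q ∉ H_i^+ for all i ∈ I. -/

import Mathlib

open Metric Set
open scoped RealInnerProductSpace

/-- The dimension of a set: the dimension of its affine span. -/
noncomputable def setDim {d : ℕ} (A : Set (EuclideanSpace ℝ (Fin d))) : ℕ :=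
  Module.finrank ℝ (affineSpan ℝ A).direction

/-- The farthest-point Voronoi face `V_S`: the set of points whose set of farthest points
of `C` is exactly `S`. -/
def vorF {d : ℕ} (C S : Set (EuclideanSpace ℝ (Fin d))) : Set (EuclideanSpace ℝ (Fin d)) :=
  {x | S = {c | c ∈ C ∧ ∀ c' ∈ C, dist x c' ≤ dist x c}}

/-- `P_{C,r}`: the intersection of the closed balls of radius `r` centered at points of `C`. -/
def ballPoly {d : ℕ} (C : Set (EuclideanSpace ℝ (Fin d))) (r : ℝ) :
    Set (EuclideanSpace ℝ (Fin d)) :=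
  ⋂ c ∈ C, closedBall c r

/-- The `r`-convex hull of `X`. -/
def rConvexHull {d : ℕ} (r : ℝ) (X : Set (EuclideanSpace ℝ (Fin d))) :
    Set (EuclideanSpace ℝ (Fin d)) :=
  ⋂ x ∈ {x | X ⊆ closedBall x r}, closedBall x r

/-- `C` lies in `r`-convex position. -/
def RConvexPosition {d : ℕ} (r : ℝ) (C : Set (EuclideanSpace ℝ (Fin d))) : Prop :=
  (∃ p, C ⊆ ball p r) ∧ ∀ c ∈ C, c ∉ rConvexHull r (C \ {c})

/-- `P_{C,r}` is a basic `r`-ball polyhedron with center-polytope `conv C`. -/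
def IsBasicBallPolyhedron {d : ℕ} (C : Set (EuclideanSpace ℝ (Fin d))) (r : ℝ) : Prop :=
  0 < r ∧ C.Finite ∧ d + 1 ≤ C.ncard ∧ 2 ≤ d ∧
  setDim (convexHull ℝ C) = d ∧
  C = Set.extremePoints ℝ (convexHull ℝ C) ∧
  RConvexPosition r C ∧
  ∀ S ⊆ C, ∀ v, vorF C S = {v} → v ∈ interior (ballPoly C r)

/-- `fFace C r k` is the number of `(k-1)`-dimensional faces of `P_{C,r}`, i.e. the number of
`S ⊆ C` with `V_S ∩ bd(P_{C,r}) ≠ ∅` and `dim V_S = k`. -/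
noncomputable def fFace {d : ℕ} (C : Set (EuclideanSpace ℝ (Fin d))) (r : ℝ) (k : ℕ) : ℕ :=
  {S : Set (EuclideanSpace ℝ (Fin d)) | S ⊆ C ∧
    (vorF C S ∩ frontier (ballPoly C r)).Nonempty ∧ setDim (vorF C S) = k}.ncard

/-- The recession cone of a set `A`. -/
def recCone {m : ℕ} (A : Set (EuclideanSpace ℝ (Fin m))) : Set (EuclideanSpace ℝ (Fin m)) :=
  {y | ∀ x ∈ A, ∀ l : ℝ, 0 ≤ l → x + l • y ∈ A}

/-- Recession directions of a nonempty set contained in a half-space make a nonpositive inner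
product with its outer normal. -/
theorem inner_nonpos_of_mem_recCone {m : ℕ} {A : Set (EuclideanSpace ℝ (Fin m))}
    (hA : A.Nonempty) {a y : EuclideanSpace ℝ (Fin m)} {b : ℝ} (h : ∀ x ∈ A, ⟪a, x⟫ ≤ b)
    (hy : y ∈ recCone A) : ⟪a, y⟫ ≤ 0 := by
  obtain ⟨x, hx⟩ := hA
  by_contra! hpos
  have hx' := h x hx
  have key := h _ (hy x hx ((b - ⟪a, x⟫ + 1) / ⟪a, y⟫) (div_nonneg (by linarith) hpos.le))
  rw [inner_add_right, real_inner_smul_right, div_mul_cancel₀ _ hpos.ne'] at key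
  linarith

/-- A spanning set contains a vector that is not orthogonal to a given nonzero vector. -/
theorem exists_inner_ne_zero_of_span_eq_top {E : Type*} [NormedAddCommGroup E]
    [InnerProductSpace ℝ E] {S : Set E} (hS : Submodule.span ℝ S = ⊤) {a : E} (ha : a ≠ 0) :
    ∃ y ∈ S, ⟪a, y⟫ ≠ 0 := by
  by_contra! h
  have hle : Submodule.span ℝ S ≤ LinearMap.ker (innerₛₗ ℝ a) :=
    Submodule.span_le.2 fun y hy => by simpa using h y hy
  have : a ∈ LinearMap.ker (innerₛₗ ℝ a) := hle (hS ▸ Submodule.mem_top)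
  exact ha (inner_self_eq_zero (𝕜 := ℝ).1 (by
    simpa only [LinearMap.mem_ker, innerₛₗ_apply_apply] using this))

/-- an irredundant finite intersection of closed half-spaces with nonempty
interior and full-dimensional recession cone can be illuminated by a single point source. -/
theorem stmt7 (l : ℕ) {ι : Type} [Fintype ι]
    (a : ι → EuclideanSpace ℝ (Fin (l + 1))) (b : ι → ℝ) (ha : ∀ i, a i ≠ 0)
    (Q : Set (EuclideanSpace ℝ (Fin (l + 1))))
    (hQ : Q = ⋂ i, {x | ⟪a i, x⟫ ≤ b i})
    (hint : (interior Q).Nonempty)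
    (hirr : ∀ i : ι, (⋂ j, ⋂ _ : j ≠ i, {x | ⟪a j, x⟫ ≤ b j}) ≠ Q)
    (hrec : Module.finrank ℝ (Submodule.span ℝ (recCone Q)) = l + 1) :
    ∃ q : EuclideanSpace ℝ (Fin (l + 1)), ∀ i, q ∉ {x | ⟪a i, x⟫ ≤ b i} := by
  have hne : Q.Nonempty := hint.mono interior_subset
  have hle : ∀ i, ∀ y ∈ recCone Q, ⟪a i, y⟫ ≤ 0 := fun i y hy =>
    inner_nonpos_of_mem_recCone hne (fun x hx => by
      rw [hQ] at hx
      exact Set.mem_iInter.1 hx i) hy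
  have htop : Submodule.span ℝ (recCone Q) = ⊤ :=
    Submodule.eq_top_of_finrank_eq (by simpa using hrec)
  choose y hy hya using fun i => exists_inner_ne_zero_of_span_eq_top htop (ha i)
  have hneg : ∀ i, ⟪a i, ∑ j, y j⟫ < 0 := fun i => by
    rw [inner_sum]
    exact Finset.sum_neg' (fun j _ => hle i _ (hy j))
      ⟨i, Finset.mem_univ i, lt_of_le_of_ne (hle i _ (hy i)) (hya i)⟩
  have hlim : ∀ᶠ t : ℝ in Filter.atTop, ∀ i, b i < t * -⟪a i, ∑ j, y j⟫ :=
    Filter.eventually_all.2 fun i =>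
      (Filter.tendsto_id.atTop_mul_const (neg_pos.2 (hneg i))).eventually_gt_atTop (b i)
  obtain ⟨t, ht⟩ := hlim.exists
  refine ⟨t • -∑ j, y j, fun i => ?_⟩
  rw [Set.mem_ofPred_eq, real_inner_smul_right, inner_neg_right, not_le]
  exact ht i
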